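/- The cubic (x+y)(y+z)(z+x) - 8xyz = 0 has exactly one singular point in ℙ²(ℂ), namely [1:1:1]. -/

import Mathlib

/-- The cubic form `F(x,y,z) = (x+y)(y+z)(z+x) - 8·xyz`. -/
noncomputable def F (x y z : ℂ) : ℂ := (x + y) * (y + z) * (z + x) + (-8) * x * y * z

/-- `(x,y,z)` is a singular point of the curve `F = 0`. -/
def IsSingularAt (x y z : ℂ) : Prop :=
  F x y z = 0 ∧
  deriv (fun s => F s y z) x = 0 ∧
  deriv (fun s => F x s z) y = 0 ∧
  deriv (fun s => F x y s) z = 0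

theorem deriv_quad_aux (a b c t : ℂ) :
    deriv (fun s : ℂ => a * s ^ 2 + b * s + c) t = 2 * a * t + b := by
  have h := ((((hasDerivAt_id t).pow 2).const_mul a).add
    ((hasDerivAt_id t).const_mul b)).add_const c
  have h2 : HasDerivAt (fun s : ℂ => a * s ^ 2 + b * s + c) (2 * a * t + b) t := by
    refine (h.congr_deriv ?_)
    simp only [id, Nat.cast_ofNat]
    ring
  exact h2.deriv

theorem isSingularAt_iff_aux (x y z : ℂ) : IsSingularAt x y z ↔
    F x y z = 0 ∧ (y + z) * (2 * x + y + z) - 8 * y * z = 0 ∧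
    (x + z) * (2 * y + x + z) - 8 * x * z = 0 ∧
    (x + y) * (2 * z + x + y) - 8 * x * y = 0 := by
  have h1 : (fun s => F s y z) = fun s : ℂ =>
      (y + z) * s ^ 2 + ((y + z) ^ 2 - 8 * y * z) * s + y * z * (y + z) := by
    funext s; unfold F; ring
  have h2 : (fun s => F x s z) = fun s : ℂ =>
      (x + z) * s ^ 2 + ((x + z) ^ 2 - 8 * x * z) * s + x * z * (x + z) := by
    funext s; unfold F; ring
  have h3 : (fun s => F x y s) = fun s : ℂ =>
      (x + y) * s ^ 2 + ((x + y) ^ 2 - 8 * x * y) * s + x * y * (x + y) := by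
    funext s; unfold F; ring
  unfold IsSingularAt
  rw [h1, h2, h3, deriv_quad_aux, deriv_quad_aux, deriv_quad_aux]
  ring_nf

theorem stmt11 :
    IsSingularAt 1 1 1 ∧
    ∀ x y z : ℂ, ¬ (x = 0 ∧ y = 0 ∧ z = 0) → IsSingularAt x y z →
      ∃ c : ℂ, c ≠ 0 ∧ x = c ∧ y = c ∧ z = c := by
  rw [isSingularAt_iff_aux]
  refine ⟨by unfold F; norm_num, ?_⟩
  intro x y z hne h
  rw [isSingularAt_iff_aux] at h
  obtain ⟨-, e1, e2, e3⟩ := h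
  have k1 : (y - x) * (x + y - 8 * z) = 0 := by linear_combination e1 - e2
  have k2 : (z - y) * (y + z - 8 * x) = 0 := by linear_combination e2 - e3
  have k3 : (z - x) * (x + z - 8 * y) = 0 := by linear_combination e1 - e3
  have key : x = y ∧ y = z := by
    rcases mul_eq_zero.1 k1 with a | a <;> rcases mul_eq_zero.1 k2 with b | b <;>
      rcases mul_eq_zero.1 k3 with c | c <;> grind
  obtain ⟨rfl, rfl⟩ := key
  exact ⟨x, fun hx => hne ⟨hx, hx, hx⟩, rfl, rfl, rfl⟩
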